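/- arXiv:1606.01970 — 7 statements merged into one kernel-verified Lean document; each statement's English description precedes it below -/
import Mathlib

section
/- Let f : [0,∞) → [0,∞) be continuous and let b > 0 be such that f is strictly increasing on (0,b], the map x ↦ f(x)/x is strictly decreasing on (0,b], and f(b)/b > f(x)/x for all x > b. Assume in addition that f(b) ≤ b and that lim_{x→0⁺} f(x)/x > 1 (possibly infinite). Then there exists a unique x* ∈ (0,b] with f(x*) = x*; moreover f(x) ≥ x for all x ∈ [0, x*] and f(x) < x for all x > x*. -/
open Set Filter

/-- If `f` satisfies Assumption (S) except that `f b ≤ b`, and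
`lim_{x→0⁺} f x / x > 1` (possibly infinite), then `f` has a unique fixed point
`x* ∈ (0,b]`, with `f x ≥ x` on `[0,x*]` and `f x < x` for `x > x*`. -/
theorem stmt_3
    (f : ℝ → ℝ) (b : ℝ)
    (hf_cont : ContinuousOn f (Set.Ici 0))
    (hf_nonneg : ∀ x, 0 ≤ x → 0 ≤ f x)
    (hb : 0 < b)
    (hmono : StrictMonoOn f (Set.Ioc 0 b))
    (hratio : StrictAntiOn (fun x => f x / x) (Set.Ioc 0 b))
    (hslope : ∀ x, b < x → f x / x < f b / b)
    (hfb : f b ≤ b)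
    (hlim : Filter.Tendsto (fun x => f x / x) (nhdsWithin 0 (Set.Ioi 0)) Filter.atTop ∨
      ∃ L : ℝ, 1 < L ∧
        Filter.Tendsto (fun x => f x / x) (nhdsWithin 0 (Set.Ioi 0)) (nhds L)) :
    ∃ xs : ℝ, (xs ∈ Set.Ioc 0 b ∧ f xs = xs) ∧
      (∀ y ∈ Set.Ioc 0 b, f y = y → y = xs) ∧
      (∀ x ∈ Set.Icc 0 xs, x ≤ f x) ∧
      (∀ x, xs < x → f x < x) := by
  have h_ev : ∀ᶠ x in nhdsWithin 0 (Set.Ioi 0), 1 < f x / x := by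
    rcases hlim with h | ⟨L, hL, h⟩
    · exact h.eventually_gt_atTop 1
    · exact h.eventually_const_lt hL
  obtain ⟨a, ha, ha0, hab⟩ := (h_ev.and (Ioo_mem_nhdsGT hb)).exists
  have hfa : a < f a := (one_lt_div ha0).mp ha
  have h_cont : ContinuousOn (fun x => f x - x) (Set.Icc a b) :=
    (hf_cont.mono fun x hx => ha0.le.trans hx.1).sub continuousOn_id
  obtain ⟨xs, ⟨hax, hxb⟩, hfix⟩ := intermediate_value_Icc' hab.le h_cont
    (show (0 : ℝ) ∈ Set.Icc (f b - b) (f a - a) from ⟨by linarith, by linarith⟩)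
  have hxs : f xs = xs := sub_eq_zero.mp hfix
  have hx0 : 0 < xs := ha0.trans_le hax
  have hmem : xs ∈ Set.Ioc 0 b := ⟨hx0, hxb⟩
  have hone : f xs / xs = 1 := by rw [hxs, div_self hx0.ne']
  refine ⟨xs, ⟨hmem, hxs⟩, fun y hy hfy => ?_, fun x hx => ?_, fun x hx => ?_⟩
  · refine hratio.injOn hy hmem ?_
    simp only [hone, hfy, div_self hy.1.ne']
  · rcases hx.1.eq_or_lt with rfl | hpos
    · exact hf_nonneg 0 le_rfl
    · have h := hratio.antitoneOn ⟨hpos, hx.2.trans hxb⟩ hmem hx.2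
      simp only [hone] at h
      exact (one_le_div hpos).mp h
  · have hpos := hx0.trans hx
    rw [← div_lt_one hpos]
    rcases le_or_gt x b with hle | hlt
    · have h := hratio hmem ⟨hpos, hle⟩ hx
      simpa only [hone] using h
    · exact (hslope x hlt).trans_le ((div_le_one hb).mpr hfb)
end

section
/- Let f satisfy Assumption (S) with parameter b, define Φ(x) := x/f(x) on (0,b] and Φ(0) := lim_{x→0⁺} x/f(x), and let Φ⁻¹ denote the inverse of Φ. Let μ₁ ∈ (Φ(0), Φ(b)), μ₂ ∈ (Φ(0), μ₁), set y₁ := Φ⁻¹(μ₁), y₂ := Φ⁻¹(μ₂) (so 0 < y₂ < y₁ < b), and let ε ∈ (0, min{y₂, b − y₁}). Let (ν_n)_{n≥0} be any sequence with ν_n ∈ [μ₂, μ₁] for all n, and let (x_n) solve x_{n+1} = f(ν_n x_n) with x₀ > 0. Then the interval (y₂ − ε, y₁ + ε) is forward invariant: if ν_n x_n ∈ (y₂ − ε, y₁ + ε) for some n, then ν_{n+1} x_{n+1} ∈ (y₂ − ε, y₁ + ε). -/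
open Set Filter

/-- (Invariance, Remark after Lemma 3.1) Under Assumption (S),
with `y₁ = Φ⁻¹ μ₁`, `y₂ = Φ⁻¹ μ₂` and `ε ∈ (0, min{y₂, b − y₁})`, the interval
`(y₂ − ε, y₁ + ε)` is forward invariant for `ν_n x_n` along solutions of
`x_{n+1} = f (ν_n x_n)` with `ν_n ∈ [μ₂, μ₁]`. -/
theorem stmt_5
    (f : ℝ → ℝ) (b : ℝ)
    (hf_cont : ContinuousOn f (Set.Ici 0))
    (hf_nonneg : ∀ x, 0 ≤ x → 0 ≤ f x)
    (hb : 0 < b)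
    (hmono : StrictMonoOn f (Set.Ioc 0 b))
    (hratio : StrictAntiOn (fun x => f x / x) (Set.Ioc 0 b))
    (hfb : b < f b)
    (hslope : ∀ x, b < x → f x / x < f b / b)
    (Φ0 : ℝ)
    (hΦ0 : Filter.Tendsto (fun x => x / f x) (nhdsWithin 0 (Set.Ioi 0)) (nhds Φ0))
    (Ψ : ℝ → ℝ)
    (hΨ : ∀ y ∈ Set.Ioo Φ0 (b / f b), Ψ y ∈ Set.Ioo 0 b ∧ Ψ y / f (Ψ y) = y)
    (μ1 μ2 : ℝ) (hμ1 : μ1 ∈ Set.Ioo Φ0 (b / f b)) (hμ2 : μ2 ∈ Set.Ioo Φ0 μ1)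
    (y1 y2 : ℝ) (hy1 : y1 = Ψ μ1) (hy2 : y2 = Ψ μ2)
    (ε : ℝ) (hε : 0 < ε) (hε' : ε < min y2 (b - y1))
    (ν : ℕ → ℝ) (hν : ∀ n, ν n ∈ Set.Icc μ2 μ1)
    (x : ℕ → ℝ) (hx0 : 0 < x 0)
    (hrec : ∀ n, x (n + 1) = f (ν n * x n)) :
    ∀ n, ν n * x n ∈ Set.Ioo (y2 - ε) (y1 + ε) →
      ν (n + 1) * x (n + 1) ∈ Set.Ioo (y2 - ε) (y1 + ε) := by
  have hpos : ∀ w ∈ Set.Ioc 0 b, 0 < f w := fun w hw =>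
    (hf_nonneg (w / 2) (by linarith [hw.1])).trans_lt
      (hmono ⟨by linarith [hw.1], by linarith [hw.1, hw.2]⟩ hw (by linarith [hw.1]))
  obtain ⟨⟨hy1pos, hy1b⟩, hfix1⟩ := hΨ μ1 hμ1
  obtain ⟨⟨hy2pos, hy2b⟩, hfix2⟩ := hΨ μ2 ⟨hμ2.1, hμ2.2.trans hμ1.2⟩
  rw [← hy1] at hy1pos hy1b hfix1
  rw [← hy2] at hy2pos hy2b hfix2
  have hfy1 := hpos y1 ⟨hy1pos, hy1b.le⟩
  have hfy2 := hpos y2 ⟨hy2pos, hy2b.le⟩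
  obtain ⟨hε2, hε1⟩ := lt_min_iff.mp hε'
  have hμ1pos : 0 < μ1 := hfix1 ▸ div_pos hy1pos hfy1
  have hμ2pos : 0 < μ2 := hfix2 ▸ div_pos hy2pos hfy2
  have hupper : μ1 * f (y1 + ε) < y1 + ε := by
    have h : f (y1 + ε) / (y1 + ε) < f y1 / y1 :=
      hratio ⟨hy1pos, hy1b.le⟩ ⟨by linarith, by linarith⟩ (by linarith)
    rw [div_lt_div_iff₀ (by linarith) hy1pos] at h
    rw [← hfix1, div_mul_eq_mul_div, div_lt_iff₀ hfy1]
    linarith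
  have hlower : y2 - ε < μ2 * f (y2 - ε) := by
    have h : f y2 / y2 < f (y2 - ε) / (y2 - ε) :=
      hratio ⟨by linarith, by linarith⟩ ⟨hy2pos, hy2b.le⟩ (by linarith)
    rw [div_lt_div_iff₀ hy2pos (by linarith)] at h
    rw [← hfix2, div_mul_eq_mul_div, lt_div_iff₀ hfy2]
    linarith
  rintro n ⟨hl, hu⟩
  rw [hrec n]
  have hz : ν n * x n ∈ Set.Ioc 0 b := ⟨by linarith, by linarith⟩
  have hfz := hpos _ hz
  have hfl := hmono ⟨by linarith, by linarith⟩ hz hl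
  have hfu := hmono hz ⟨by linarith, by linarith⟩ hu
  constructor
  · calc y2 - ε < μ2 * f (y2 - ε) := hlower
      _ < μ2 * f (ν n * x n) := mul_lt_mul_of_pos_left hfl hμ2pos
      _ ≤ ν (n + 1) * f (ν n * x n) := mul_le_mul_of_nonneg_right (hν _).1 hfz.le
  · calc ν (n + 1) * f (ν n * x n) ≤ μ1 * f (ν n * x n) :=
          mul_le_mul_of_nonneg_right (hν _).2 hfz.le
      _ < μ1 * f (y1 + ε) := mul_lt_mul_of_pos_left hfu hμ1pos
      _ < y1 + ε := hupper
end

section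
/- Let g satisfy Assumption (G) with parameters c and unique positive fixed point x*, and let d satisfy 0 < d < min{ c − g(c), max_{x∈[0,x*]} (g(x) − x) }. Define y₁ := sup{ x ∈ [0, x*] : g(x) − x ≥ d } and y₂ := inf{ x ∈ [x*, c] : g(x) − x ≤ −d }. Then y₁ and y₂ are well defined and satisfy 0 < y₁ < x* < y₂ < c, g(y₁) − d = y₁, and g(y₂) + d = y₂; moreover y₂ is the unique solution of g(x) + d = x on [x*, ∞), and g(x) + d < x for all x > y₂. -/
open Set Filter

/-- (Lemma 4.1 (i),(ii)) Under Assumption (G) with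
`0 < d < min{c − g(c), max_{[0,x*]}(g(x)−x)}`, the numbers
`y₁ = sup{x ∈ [0,x*] : g(x)−x ≥ d}` and `y₂ = inf{x ∈ [x*,c] : g(x)−x ≤ −d}`
satisfy `0 < y₁ < x* < y₂ < c`, `g(y₁) − d = y₁`, `g(y₂) + d = y₂`; moreover `y₂`
is the unique solution of `g(x) + d = x` on `[x*, ∞)` and `g(x) + d < x` for
`x > y₂`. -/
theorem stmt_10
    (g : ℝ → ℝ) (c : ℝ)
    (hg_cont : ContinuousOn g (Set.Ici 0))
    (hg_nonneg : ∀ x, 0 ≤ x → 0 ≤ g x)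
    (hc : 0 < c)
    (hmono : StrictMonoOn g (Set.Ioc 0 c))
    (hratio : StrictAntiOn (fun x => g x / x) (Set.Ioc 0 c))
    (hslope : ∀ x, c < x → g x / x < g c / c)
    (xs : ℝ) (hxs : xs ∈ Set.Ioo 0 c) (hfix : g xs = xs)
    (huniq : ∀ x, 0 < x → g x = x → x = xs)
    (d : ℝ) (hdpos : 0 < d)
    (hd : d < min (c - g c) (sSup ((fun x => g x - x) '' Set.Icc 0 xs)))
    (y1 y2 : ℝ)
    (hy1 : y1 = sSup {x | x ∈ Set.Icc 0 xs ∧ d ≤ g x - x})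
    (hy2 : y2 = sInf {x | x ∈ Set.Icc xs c ∧ g x - x ≤ -d}) :
    0 < y1 ∧ y1 < xs ∧ xs < y2 ∧ y2 < c ∧
    g y1 - d = y1 ∧ g y2 + d = y2 ∧
    (∀ x, xs ≤ x → g x + d = x → x = y2) ∧
    (∀ x, y2 < x → g x + d < x) := by
  obtain ⟨hxs0, hxsc⟩ := hxs
  obtain ⟨hdc, hdmax⟩ := lt_min_iff.mp hd
  have hcont : ContinuousOn (fun x => g x - x) (Ici 0) := hg_cont.sub continuousOn_id
  have ivt : ∀ a b v : ℝ, 0 ≤ a → a ≤ b → v ≤ g a - a → g b - b ≤ v →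
      ∃ z ∈ Icc a b, g z - z = v := fun a b v ha hab hva hbv =>
    intermediate_value_Icc' hab (hcont.mono fun x hx => ha.trans hx.1) ⟨hbv, hva⟩
  have hne1 : ∃ z, 0 < z ∧ z ≤ xs ∧ g z - z = d := by
    obtain ⟨_, ⟨x, hx, rfl⟩, hxd⟩ :=
      exists_lt_of_lt_csSup ((nonempty_Icc.mpr hxs0.le).image _) hdmax
    simp only at hxd
    obtain ⟨z, hz, hzd⟩ := ivt x xs d hx.1 hx.2 hxd.le (by linarith)
    have hzx : x ≠ z := by rintro rfl; linarith
    exact ⟨z, hx.1.trans_lt (lt_of_le_of_ne hz.1 hzx), hz.2, hzd⟩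
  have hne2 : ∃ z, xs ≤ z ∧ z < c ∧ g z - z = -d := by
    obtain ⟨z, hz, hzd⟩ := ivt xs c (-d) hxs0.le hxsc.le (by linarith) (by linarith)
    have hzc : z ≠ c := by rintro rfl; linarith
    exact ⟨z, hz.1, lt_of_le_of_ne hz.2 hzc, hzd⟩
  have hbdd1 : BddAbove {x | x ∈ Icc 0 xs ∧ d ≤ g x - x} := ⟨xs, fun x hx => hx.1.2⟩
  have hbdd2 : BddBelow {x | x ∈ Icc xs c ∧ g x - x ≤ -d} := ⟨xs, fun x hx => hx.1.1⟩
  have hclosed1 : IsClosed {x | x ∈ Icc 0 xs ∧ d ≤ g x - x} :=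
    (hcont.mono fun x hx => hx.1).preimage_isClosed_of_isClosed
      (isClosed_Icc (a := 0) (b := xs)) (isClosed_Ici (a := d))
  have hclosed2 : IsClosed {x | x ∈ Icc xs c ∧ g x - x ≤ -d} :=
    (hcont.mono fun x hx => hxs0.le.trans hx.1).preimage_isClosed_of_isClosed
      (isClosed_Icc (a := xs) (b := c)) (isClosed_Iic (a := -d))
  obtain ⟨z1, hz1, hz1xs, hz1d⟩ := hne1
  obtain ⟨z2, hz2, hz2c, hz2d⟩ := hne2
  have hle1 : ∀ x, 0 ≤ x → x ≤ xs → d ≤ g x - x → x ≤ y1 := fun x h0 h1 h2 =>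
    hy1 ▸ le_csSup hbdd1 ⟨⟨h0, h1⟩, h2⟩
  have hle2 : ∀ x, xs ≤ x → x ≤ c → g x - x ≤ -d → y2 ≤ x := fun x h0 h1 h2 =>
    hy2 ▸ csInf_le hbdd2 ⟨⟨h0, h1⟩, h2⟩
  have hmem1 : y1 ∈ {x | x ∈ Icc 0 xs ∧ d ≤ g x - x} :=
    hy1 ▸ hclosed1.csSup_mem ⟨z1, ⟨hz1.le, hz1xs⟩, hz1d.ge⟩ hbdd1
  have hmem2 : y2 ∈ {x | x ∈ Icc xs c ∧ g x - x ≤ -d} :=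
    hy2 ▸ hclosed2.csInf_mem ⟨z2, ⟨hz2, hz2c.le⟩, hz2d.le⟩ hbdd2
  obtain ⟨⟨hy1_nonneg, hy1_le⟩, hy1d⟩ := hmem1
  obtain ⟨⟨hy2_ge, hy2_le⟩, hy2d⟩ := hmem2
  have hy1_pos : 0 < y1 := hz1.trans_le (hle1 z1 hz1.le hz1xs hz1d.ge)
  have hy2_lt : y2 < c := (hle2 z2 hz2 hz2c.le hz2d.le).trans_lt hz2c
  have hy1_lt : y1 < xs := lt_of_le_of_ne hy1_le (by intro h; rw [h] at hy1d; linarith)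
  have hy2_gt : xs < y2 := lt_of_le_of_ne hy2_ge (by intro h; rw [← h] at hy2d; linarith)
  have heq1 : g y1 - y1 = d := by
    obtain ⟨z, hz, hzd⟩ := ivt y1 xs d hy1_nonneg hy1_le hy1d (by linarith)
    rwa [le_antisymm (hle1 z (hy1_nonneg.trans hz.1) hz.2 hzd.ge) hz.1] at hzd
  have heq2 : g y2 - y2 = -d := by
    obtain ⟨z, hz, hzd⟩ := ivt xs y2 (-d) hxs0.le hy2_ge (by linarith) hy2d
    rwa [le_antisymm hz.2 (hle2 z hz.1 (hz.2.trans hy2_le) hzd.le)] at hzd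
  have hy2_pos : 0 < y2 := hxs0.trans hy2_gt
  have habove : ∀ x, y2 < x → g x + d < x := by
    intro x hx
    have hx0 : 0 < x := hy2_pos.trans hx
    have hslope_lt : g x / x < g y2 / y2 := by
      rcases le_or_gt x c with hxc | hxc
      · exact hratio ⟨hy2_pos, hy2_le⟩ ⟨hx0, hxc⟩ hx
      · exact (hslope x hxc).trans (hratio ⟨hy2_pos, hy2_le⟩ ⟨hc, le_rfl⟩ hy2_lt)
    have hd_lt : d / x < d / y2 := div_lt_div_of_pos_left hdpos hy2_pos hx
    have hone : g y2 / y2 + d / y2 = 1 := by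
      rw [← add_div, div_eq_one_iff_eq hy2_pos.ne']
      linarith
    rw [← div_lt_one hx0, add_div]
    linarith
  refine ⟨hy1_pos, hy1_lt, hy2_gt, hy2_lt, by linarith, by linarith, ?_, habove⟩
  intro x hx hxd
  rcases lt_trichotomy x y2 with h | h | h
  · exact absurd (hle2 x hx (h.le.trans hy2_le) (by linarith)) h.not_ge
  · exact h
  · exact absurd hxd (habove x h).ne
end

section
/- Let g satisfy Assumption (G) with parameters c and unique positive fixed point x*, and let d satisfy 0 < d < min{ c − g(c), max_{x∈[0,x*]} (g(x) − x) }. With y₁ := sup{ x ∈ [0, x*] : g(x) − x ≥ d }, define y₃ := inf{ x ∈ [x*, ∞) : g(x) − d ≤ y₁ }, with y₃ := ∞ if this set is empty. Then y₃ > c, and g(x) − d ≥ y₁ for all x ∈ [y₁, y₃] when y₃ < ∞ (respectively, for all x ∈ [y₁, ∞) when y₃ = ∞). -/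
open Set Filter

/-- A continuous function that is strictly increasing on `(a, b]` is so on `[a, b]`. -/
theorem StrictMonoOn.Icc_of_continuousOn {f : ℝ → ℝ} {a b : ℝ}
    (hf : StrictMonoOn f (Set.Ioc a b)) (hcont : ContinuousOn f (Set.Icc a b)) :
    StrictMonoOn f (Set.Icc a b) := by
  intro x hx y hy hxy
  rcases hx.1.eq_or_lt with rfl | hax
  · obtain ⟨m, ham, hmy⟩ := exists_between hxy
    have hsub : Set.Ioc a m ⊆ Set.Icc a b := fun z hz => ⟨hz.1.le, hz.2.trans (hmy.le.trans hy.2)⟩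
    have hle : f a ≤ f m := by
      refine ContinuousWithinAt.closure_le (s := Set.Ioc a m) ?_ ((hcont a hx).mono hsub)
        continuousWithinAt_const fun z hz => ?_
      · rw [closure_Ioc ham.ne]
        exact Set.left_mem_Icc.2 ham.le
      · exact hf.monotoneOn ⟨hz.1, (hsub hz).2⟩ ⟨ham, hmy.le.trans hy.2⟩ hz.2
    exact hle.trans_lt (hf ⟨ham, hmy.le.trans hy.2⟩ ⟨hxy, hy.2⟩ hmy)
  · exact hf ⟨hax, hx.2⟩ ⟨hax.trans hxy, hy.2⟩ hxy

/-- (Lemma 4.1 (iii)) Under Assumption (G) with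
`0 < d < min{c − g(c), max_{[0,x*]}(g(x)−x)}` and
`y₁ = sup{x ∈ [0,x*] : g(x)−x ≥ d}`, the number
`y₃ = inf{x ∈ [x*,∞) : g(x)−d ≤ y₁}` (`= ∞` if the set is empty) satisfies
`y₃ > c`, and `g(x) − d ≥ y₁` on `[y₁, y₃]` (on `[y₁, ∞)` when `y₃ = ∞`). -/
theorem stmt_11
    (g : ℝ → ℝ) (c : ℝ)
    (hg_cont : ContinuousOn g (Set.Ici 0))
    (hg_nonneg : ∀ x, 0 ≤ x → 0 ≤ g x)
    (hc : 0 < c)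
    (hmono : StrictMonoOn g (Set.Ioc 0 c))
    (hratio : StrictAntiOn (fun x => g x / x) (Set.Ioc 0 c))
    (hslope : ∀ x, c < x → g x / x < g c / c)
    (xs : ℝ) (hxs : xs ∈ Set.Ioo 0 c) (hfix : g xs = xs)
    (huniq : ∀ x, 0 < x → g x = x → x = xs)
    (d : ℝ) (hdpos : 0 < d)
    (hd : d < min (c - g c) (sSup ((fun x => g x - x) '' Set.Icc 0 xs)))
    (y1 : ℝ)
    (hy1 : y1 = sSup {x | x ∈ Set.Icc 0 xs ∧ d ≤ g x - x}) :
    ({w : ℝ | xs ≤ w ∧ g w - d ≤ y1}.Nonempty →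
      c < sInf {w : ℝ | xs ≤ w ∧ g w - d ≤ y1} ∧
      ∀ x ∈ Set.Icc y1 (sInf {w : ℝ | xs ≤ w ∧ g w - d ≤ y1}), y1 ≤ g x - d) ∧
    (¬ {w : ℝ | xs ≤ w ∧ g w - d ≤ y1}.Nonempty →
      ∀ x ∈ Set.Ici y1, y1 ≤ g x - d) := by
  obtain ⟨hxs0, hxsc⟩ := hxs
  obtain ⟨-, hdmax⟩ := lt_min_iff.1 hd
  have hmono' : StrictMonoOn g (Set.Icc 0 c) :=
    hmono.Icc_of_continuousOn (hg_cont.mono Set.Icc_subset_Ici_self)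
  have hcont : ContinuousOn (fun x => g x - x) (Set.Icc 0 xs) :=
    (hg_cont.mono Set.Icc_subset_Ici_self).sub continuousOn_id
  have hA : IsCompact {x | x ∈ Set.Icc 0 xs ∧ d ≤ g x - x} :=
    isCompact_Icc.of_isClosed_subset
      (hcont.preimage_isClosed_of_isClosed isClosed_Icc isClosed_Ici) fun x hx => hx.1
  have hA_ne : {x | x ∈ Set.Icc 0 xs ∧ d ≤ g x - x}.Nonempty := by
    obtain ⟨_, ⟨m, hm, rfl⟩, hdm⟩ := exists_lt_of_lt_csSup
      ((Set.nonempty_Icc.2 hxs0.le).image _) hdmax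
    exact ⟨m, hm, hdm.le⟩
  obtain ⟨⟨hy0, hyxs⟩, hdy⟩ := hA.sSup_mem hA_ne
  rw [← hy1] at hy0 hyxs hdy
  have hyxs' : y1 < xs := by
    refine hyxs.lt_of_ne ?_
    rintro rfl
    linarith
  have hleft : ∀ x ∈ Set.Icc y1 c, y1 ≤ g x - d := fun x hx => by
    have := hmono'.monotoneOn ⟨hy0, hx.1.trans hx.2⟩ ⟨hy0.trans hx.1, hx.2⟩ hx.1
    linarith
  have hmid : ∀ x ∈ Set.Icc xs c, y1 < g x - d := fun x hx => by
    have := hmono' ⟨hy0, hyxs.trans hxsc.le⟩ ⟨hxs0.le.trans hx.1, hx.2⟩ (hyxs'.trans_le hx.1)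
    linarith
  refine ⟨fun hne => ?_, fun hne x hx => ?_⟩
  · have hclosed : IsClosed {w : ℝ | xs ≤ w ∧ g w - d ≤ y1} :=
      ((hg_cont.mono (Set.Ici_subset_Ici.2 hxs0.le)).sub
        continuousOn_const).preimage_isClosed_of_isClosed isClosed_Ici isClosed_Iic
    have hbdd : BddBelow {w : ℝ | xs ≤ w ∧ g w - d ≤ y1} := ⟨xs, fun w hw => hw.1⟩
    have hmem := hclosed.csInf_mem hne hbdd
    have hlb := fun w hw => csInf_le hbdd (a := w) hw
    generalize sInf {w : ℝ | xs ≤ w ∧ g w - d ≤ y1} = y3 at hmem hlb ⊢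
    obtain ⟨hxy3, hy3⟩ := hmem
    have hc3 : c < y3 := by
      by_contra! h
      exact (hmid y3 ⟨hxy3, h⟩).not_ge hy3
    refine ⟨hc3, fun x hx => ?_⟩
    rcases le_total x c with hxc | hcx
    · exact hleft x ⟨hx.1, hxc⟩
    · have hcx_cont : ContinuousOn (fun w => g w - d) (Set.Icc c x) :=
        (hg_cont.mono fun w hw => hc.le.trans hw.1).sub continuousOn_const
      by_contra! hlt
      obtain ⟨w, hw, hgw⟩ := intermediate_value_Icc' hcx hcx_cont
        ⟨hlt.le, hleft c ⟨hyxs.trans hxsc.le, le_rfl⟩⟩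
      have hwy : y3 ≤ w := hlb w ⟨hxsc.le.trans hw.1, hgw.le⟩
      have hwx : w = x := le_antisymm hw.2 (hx.2.trans hwy)
      subst hwx
      exact hlt.ne hgw
  · rcases le_total x c with hxc | hcx
    · exact hleft x ⟨hx, hxc⟩
    · by_contra! hlt
      exact hne ⟨x, hxsc.le.trans hcx, hlt.le⟩
end

section
/- Let g satisfy Assumption (G) with parameters c and unique positive fixed point x*, let d satisfy 0 < d < min{ c − g(c), max_{x∈[0,x*]} (g(x) − x) }, and define y₁ := sup{ x ∈ [0, x*] : g(x) − x ≥ d }, y₂ := inf{ x ∈ [x*, c] : g(x) − x ≤ −d }, y₃ := inf{ x ∈ [x*, ∞) : g(x) − d ≤ y₁ } (y₃ := ∞ if this set is empty). Let (r_n)_{n≥0} be any sequence with −d ≤ r_n ≤ d, and let (x_n) solve x_{n+1} = max{ g(x_n) + r_n, 0 } with x₀ ∈ [y₁, y₃]. Then: (i) for each ε > 0 there exists N = N(ε, x₀) such that y₁ ≤ x_n ≤ y₂ + ε for all n ≥ N; (ii) liminf_{n→∞} x_n ≥ y₁ and limsup_{n→∞} x_n ≤ y₂. -/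
open Set Filter

/-- A real sequence whose positive excess over `b` contracts geometrically is eventually below
`b + ε` for every `ε > 0`. -/
lemma eventually_le_add_of_excess_contracts {x : ℕ → ℝ} {b q : ℝ} (hq0 : 0 ≤ q) (hq1 : q < 1)
    (hstep : ∀ n, x (n + 1) - b ≤ q * max (x n - b) 0) {ε : ℝ} (hε : 0 < ε) :
    ∃ N : ℕ, ∀ n ≥ N, x n ≤ b + ε := by
  have hgeom : ∀ n, max (x n - b) 0 ≤ q ^ n * max (x 0 - b) 0 := by
    intro n
    induction n with
    | zero => simp
    | succ n ih =>
      have h0 : 0 ≤ q ^ (n + 1) * max (x 0 - b) 0 := by positivity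
      refine max_le ((hstep n).trans ?_) h0
      calc q * max (x n - b) 0 ≤ q * (q ^ n * max (x 0 - b) 0) := by gcongr
        _ = q ^ (n + 1) * max (x 0 - b) 0 := by ring
  have hlim : Tendsto (fun n : ℕ => q ^ n * max (x 0 - b) 0) atTop (nhds 0) := by
    simpa using (tendsto_pow_atTop_nhds_zero_of_lt_one hq0 hq1).mul_const (max (x 0 - b) 0)
  obtain ⟨N, hN⟩ := eventually_atTop.1 (hlim.eventually (gt_mem_nhds hε))
  refine ⟨N, fun n hn => ?_⟩
  linarith [hN n hn, hgeom n, le_max_left (x n - b) 0]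

/-- The last point of `[0, b]` at which a continuous `f` is at least `d` is positive and `f` is
at least `d` there, provided `f b < d` and `d` is below the supremum of `f` on `[0, b]`. -/
lemma sSup_superlevel_pos_and_mem {f : ℝ → ℝ} {b d : ℝ} (hf : ContinuousOn f (Icc 0 b))
    (hb : 0 ≤ b) (hfb : f b < d) (hd : d < sSup (f '' Icc 0 b)) :
    0 < sSup {x | x ∈ Icc 0 b ∧ d ≤ f x} ∧
      sSup {x | x ∈ Icc 0 b ∧ d ≤ f x} ∈ {x | x ∈ Icc 0 b ∧ d ≤ f x} := by
  obtain ⟨_, ⟨z, hz, rfl⟩, hdz⟩ := exists_lt_of_lt_csSup ((nonempty_Icc.2 hb).image f) hd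
  obtain ⟨p, hp, hpd⟩ := intermediate_value_Icc' hz.2
    (hf.mono (Icc_subset_Icc_left hz.1)) ⟨hfb.le, hdz.le⟩
  have hzp : z < p := lt_of_le_of_ne hp.1 (by rintro rfl; exact hdz.ne' hpd)
  have hbdd : BddAbove {x | x ∈ Icc 0 b ∧ d ≤ f x} := ⟨b, fun w hw => hw.1.2⟩
  have hmem : p ∈ {x | x ∈ Icc 0 b ∧ d ≤ f x} := ⟨⟨hz.1.trans hp.1, hp.2⟩, hpd.ge⟩
  have hclosed : IsClosed {x | x ∈ Icc 0 b ∧ d ≤ f x} :=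
    hf.preimage_isClosed_of_isClosed isClosed_Icc isClosed_Ici
  exact ⟨(hz.1.trans_lt hzp).trans_le (le_csSup hbdd hmem), hclosed.csSup_mem ⟨p, hmem⟩ hbdd⟩

/-- (Lemma 4.2) Under Assumption (G) with
`0 < d < min{c − g(c), max_{[0,x*]}(g(x)−x)}` and `y₁, y₂, y₃` as in Lemma 4.1,
every solution of `x_{n+1} = max{g(x_n) + r_n, 0}` with `−d ≤ r_n ≤ d` and
`x₀ ∈ [y₁, y₃]` satisfies: (i) for each `ε > 0`, `y₁ ≤ x_n ≤ y₂ + ε` for all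
large `n`; (ii) `liminf x_n ≥ y₁` and `limsup x_n ≤ y₂`. -/
theorem stmt_12
    (g : ℝ → ℝ) (c : ℝ)
    (hg_cont : ContinuousOn g (Set.Ici 0))
    (hg_nonneg : ∀ x, 0 ≤ x → 0 ≤ g x)
    (hc : 0 < c)
    (hmono : StrictMonoOn g (Set.Ioc 0 c))
    (hratio : StrictAntiOn (fun x => g x / x) (Set.Ioc 0 c))
    (hslope : ∀ x, c < x → g x / x < g c / c)
    (xs : ℝ) (hxs : xs ∈ Set.Ioo 0 c) (hfix : g xs = xs)
    (huniq : ∀ x, 0 < x → g x = x → x = xs)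
    (d : ℝ) (hdpos : 0 < d)
    (hd : d < min (c - g c) (sSup ((fun x => g x - x) '' Set.Icc 0 xs)))
    (y1 y2 : ℝ)
    (hy1 : y1 = sSup {x | x ∈ Set.Icc 0 xs ∧ d ≤ g x - x})
    (hy2 : y2 = sInf {x | x ∈ Set.Icc xs c ∧ g x - x ≤ -d})
    (r : ℕ → ℝ) (hr : ∀ n, -d ≤ r n ∧ r n ≤ d)
    (x : ℕ → ℝ)
    (hrec : ∀ n, x (n + 1) = max (g (x n) + r n) 0)
    (hx0l : y1 ≤ x 0)
    (hx0r : {w : ℝ | xs ≤ w ∧ g w - d ≤ y1}.Nonempty →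
      x 0 ≤ sInf {w : ℝ | xs ≤ w ∧ g w - d ≤ y1}) :
    (∀ ε > 0, ∃ N : ℕ, ∀ n ≥ N, y1 ≤ x n ∧ x n ≤ y2 + ε) ∧
    y1 ≤ Filter.liminf x Filter.atTop ∧
    Filter.limsup x Filter.atTop ≤ y2 := by
  have hxs0 : 0 < xs := hxs.1
  have hcont : ContinuousOn (fun x => g x - x) (Ici 0) := hg_cont.sub continuousOn_id
  obtain ⟨hy1pos, ⟨-, hy1xs⟩, hgy1⟩ :
      0 < y1 ∧ y1 ∈ {x | x ∈ Icc 0 xs ∧ d ≤ g x - x} := by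
    rw [hy1]
    exact sSup_superlevel_pos_and_mem (hcont.mono Icc_subset_Ici_self) hxs0.le
      (by simpa [hfix] using hdpos) (hd.trans_le (min_le_right _ _))
  obtain ⟨⟨hy2xs, hy2c⟩, hgy2⟩ : y2 ∈ {x | x ∈ Icc xs c ∧ g x - x ≤ -d} := by
    rw [hy2]
    have hclosed : IsClosed {x | x ∈ Icc xs c ∧ g x - x ≤ -d} :=
      (hcont.mono fun w hw => hxs0.le.trans hw.1).preimage_isClosed_of_isClosed
        isClosed_Icc isClosed_Iic
    refine hclosed.csInf_mem ⟨c, ⟨hxs.2.le, le_rfl⟩, ?_⟩ ⟨xs, fun w hw => hw.1.1⟩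
    linarith [hd.trans_le (min_le_left _ _)]
  have hy2pos : 0 < y2 := hxs0.trans_le hy2xs
  have hg_low : ∀ w, y1 ≤ w → w ≤ c → y1 + d ≤ g w := by
    intro w hw hwc
    have := hmono.monotoneOn ⟨hy1pos, hw.trans hwc⟩ ⟨hy1pos.trans_le hw, hwc⟩ hw
    linarith
  have hg_high : ∀ w, 0 < w → w ≤ y2 → g w + d ≤ y2 := by
    intro w hw hwy
    have := hmono.monotoneOn ⟨hw, hwy.trans hy2c⟩ ⟨hy2pos, hy2c⟩ hwy
    linarith
  have hg_lin : ∀ w, y2 < w → g w + d - y2 ≤ (1 - d / y2) * (w - y2) := by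
    intro w hw
    have hwpos : 0 < w := hy2pos.trans hw
    have hratio_le : g w / w ≤ g y2 / y2 := by
      rcases le_or_gt w c with hwc | hwc
      · exact (hratio ⟨hy2pos, hy2c⟩ ⟨hwpos, hwc⟩ hw).le
      · exact (hslope w hwc).le.trans
          (hratio.antitoneOn ⟨hy2pos, hy2c⟩ ⟨hc, le_rfl⟩ hy2c)
    have hy2le : g y2 / y2 ≤ 1 - d / y2 := by
      rw [div_le_iff₀ hy2pos, sub_mul, div_mul_cancel₀ _ hy2pos.ne']
      linarith
    have hgw : g w ≤ (1 - d / y2) * w := (div_le_iff₀ hwpos).1 (hratio_le.trans hy2le)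
    have hcancel : (1 - d / y2) * y2 = y2 - d := by
      rw [sub_mul, div_mul_cancel₀ _ hy2pos.ne', one_mul]
    rw [mul_sub, hcancel]
    linarith
  have hq0 : 0 ≤ 1 - d / y2 := by
    rw [sub_nonneg, div_le_one hy2pos]
    linarith [hg_nonneg y2 hy2pos.le]
  have hq1 : 1 - d / y2 < 1 := sub_lt_self _ (div_pos hdpos hy2pos)
  set S : Set ℝ := {w : ℝ | xs ≤ w ∧ g w - d ≤ y1} with hS
  have hSbdd : BddBelow S := ⟨xs, fun w hw => hw.1⟩
  have hcS : ∀ w ∈ S, c ≤ w := by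
    rintro w ⟨hxw, hgw⟩
    by_contra! hwc
    have hle : w ≤ y1 := (hmono.le_iff_le ⟨hxs0.trans_le hxw, hwc.le⟩
      ⟨hy1pos, hy1xs.trans hxs.2.le⟩).1 (by linarith)
    have heq : y1 = xs := le_antisymm hy1xs (hxw.trans hle)
    rw [heq, hfix] at hgy1
    linarith
  have hg_low' : ∀ u, y1 ≤ u → (S.Nonempty → u ≤ sInf S) → y1 + d ≤ g u := by
    intro u hu huS
    rcases le_or_gt u c with huc | huc
    · exact hg_low u hu huc
    · by_contra! hlt
      obtain ⟨p, hp, hgp⟩ := intermediate_value_Icc' huc.le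
        (hg_cont.mono fun w hw => hc.le.trans hw.1)
        ⟨hlt.le, hg_low c (hy1xs.trans hxs.2.le) le_rfl⟩
      have hpu : p < u := lt_of_le_of_ne hp.2 (by rintro rfl; exact hlt.ne hgp)
      have hpS : p ∈ S := ⟨hxs.2.le.trans hp.1, by linarith⟩
      exact ((huS ⟨p, hpS⟩).trans (csInf_le hSbdd hpS)).not_gt hpu
  have hinv : ∀ n, y1 ≤ x n ∧ (S.Nonempty → x n ≤ sInf S) := by
    intro n
    induction n with
    | zero => exact ⟨hx0l, hx0r⟩
    | succ n ih =>
      obtain ⟨hl, hu⟩ := ih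
      have hxpos : 0 < x n := hy1pos.trans_le hl
      rw [hrec n]
      refine ⟨le_max_of_le_left ?_, fun hne => ?_⟩
      · linarith [hg_low' (x n) hl hu, (hr n).1]
      · have hcI : c ≤ sInf S := le_csInf hne hcS
        refine max_le ?_ (hc.le.trans hcI)
        rcases le_or_gt (x n) y2 with hy | hy
        · linarith [hg_high (x n) hxpos hy, (hr n).2]
        · have := mul_le_of_le_one_left (sub_pos.2 hy).le hq1.le
          linarith [hg_lin (x n) hy, (hr n).2, hu hne]
  have hstep : ∀ n, x (n + 1) - y2 ≤ (1 - d / y2) * max (x n - y2) 0 := by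
    intro n
    have hxpos : 0 < x n := hy1pos.trans_le (hinv n).1
    rw [hrec n, sub_le_iff_le_add]
    have hnn : 0 ≤ (1 - d / y2) * max (x n - y2) 0 := mul_nonneg hq0 (le_max_right _ _)
    refine max_le ?_ (by linarith)
    rcases le_or_gt (x n) y2 with hy | hy
    · linarith [hg_high (x n) hxpos hy, (hr n).2]
    · rw [max_eq_left (sub_pos.2 hy).le]
      linarith [hg_lin (x n) hy, (hr n).2]
  have hev : ∀ ε > 0, ∃ N : ℕ, ∀ n ≥ N, x n ≤ y2 + ε := fun ε hε =>
    eventually_le_add_of_excess_contracts hq0 hq1 hstep hε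
  have hbelow : IsBoundedUnder (· ≥ ·) atTop x :=
    isBoundedUnder_of ⟨y1, fun n => (hinv n).1⟩
  have habove : IsBoundedUnder (· ≤ ·) atTop x := by
    obtain ⟨N, hN⟩ := hev 1 one_pos
    exact isBoundedUnder_of_eventually_le (eventually_atTop.2 ⟨N, hN⟩)
  refine ⟨fun ε hε => ?_, ?_, ?_⟩
  · obtain ⟨N, hN⟩ := hev ε hε
    exact ⟨N, fun n hn => ⟨(hinv n).1, hN n hn⟩⟩
  · exact le_liminf_of_le habove.isCoboundedUnder_ge (Eventually.of_forall fun n => (hinv n).1)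
  · refine le_of_forall_pos_le_add fun ε hε => ?_
    exact limsup_le_of_le hbelow.isCoboundedUnder_le (eventually_atTop.2 (hev ε hε))
end

section
/- Let f satisfy Assumption (S) with parameter b, let x* ∈ (f(0), f(b)), and set ν := f⁻¹(x*)/x* (where f⁻¹ is the inverse of f restricted to [0,b]). Define g(x) := f(ν x) and c := b/ν. Then g is continuous on [0,∞), strictly increasing on (0,c], the map x ↦ g(x)/x is strictly decreasing on (0,c], g(c)/c > g(x)/x for all x > c, g(c) < c, and x* is a fixed point of g which is the unique fixed point of g on (0,∞); in particular g satisfies Assumption (G) with parameters c and x*. -/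
open Set Filter

/-- (from the proof of Lemma 4.3) Under Assumption (S), for
`x* ∈ (f 0, f b)`, `ν = f⁻¹(x*)/x*`, `g(x) = f(ν x)` and `c = b/ν`, the function
`g` satisfies Assumption (G) with parameters `c` and unique positive fixed
point `x*`. -/
theorem stmt_13
    (f : ℝ → ℝ) (b : ℝ)
    (hf_cont : ContinuousOn f (Set.Ici 0))
    (hf_nonneg : ∀ x, 0 ≤ x → 0 ≤ f x)
    (hb : 0 < b)
    (hmono : StrictMonoOn f (Set.Ioc 0 b))
    (hratio : StrictAntiOn (fun x => f x / x) (Set.Ioc 0 b))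
    (hfb : b < f b)
    (hslope : ∀ x, b < x → f x / x < f b / b)
    (finv : ℝ → ℝ)
    (hfinv : ∀ y ∈ Set.Icc (f 0) (f b), finv y ∈ Set.Icc 0 b ∧ f (finv y) = y)
    (xs : ℝ) (hxs : xs ∈ Set.Ioo (f 0) (f b))
    (ν : ℝ) (hν : ν = finv xs / xs)
    (g : ℝ → ℝ) (hg : ∀ x, g x = f (ν * x))
    (c : ℝ) (hcdef : c = b / ν) :
    ContinuousOn g (Set.Ici 0) ∧
    (∀ x, 0 ≤ x → 0 ≤ g x) ∧
    0 < c ∧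
    StrictMonoOn g (Set.Ioc 0 c) ∧
    StrictAntiOn (fun x => g x / x) (Set.Ioc 0 c) ∧
    (∀ x, c < x → g x / x < g c / c) ∧
    g c < c ∧
    xs ∈ Set.Ioo 0 c ∧
    g xs = xs ∧
    (∀ x, 0 < x → g x = x → x = xs) := by
  have h0 : 0 ≤ f 0 := hf_nonneg 0 le_rfl
  have hxs0 : 0 < xs := h0.trans_lt hxs.1
  obtain ⟨hu, hfu⟩ := hfinv xs ⟨hxs.1.le, hxs.2.le⟩
  generalize finv xs = u at *
  have hu0 : 0 < u := by
    refine lt_of_le_of_ne hu.1 ?_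
    rintro rfl
    exact hxs.1.ne hfu
  have hub : u < b := by
    refine lt_of_le_of_ne hu.2 ?_
    rintro rfl
    exact hxs.2.ne hfu.symm
  have hν0 : 0 < ν := hν ▸ div_pos hu0 hxs0
  have hνxs : ν * xs = u := by rw [hν]; field_simp
  have hνc : ν * c = b := by rw [hcdef]; field_simp
  have hc0 : 0 < c := hcdef ▸ div_pos hb hν0
  have hgdiv : ∀ x, g x / x = ν * (f (ν * x) / (ν * x)) := by
    intro x
    rw [hg, mul_div_assoc', mul_div_mul_left _ _ hν0.ne']
  have hmaps : ∀ x ∈ Ioc 0 c, ν * x ∈ Ioc 0 b := fun x hx =>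
    ⟨mul_pos hν0 hx.1, hνc ▸ mul_le_mul_of_nonneg_left hx.2 hν0.le⟩
  have hxsc : xs ∈ Ioo 0 c :=
    ⟨hxs0, lt_of_mul_lt_mul_left (by rwa [hνxs, hνc]) hν0.le⟩
  have hgxs : g xs = xs := by rw [hg, hνxs, hfu]
  have hganti : StrictAntiOn (fun x => g x / x) (Ioc 0 c) := by
    intro x hx y hy hxy
    simp only [hgdiv]
    exact mul_lt_mul_of_pos_left
      (hratio (hmaps x hx) (hmaps y hy) (mul_lt_mul_of_pos_left hxy hν0)) hν0
  have hgslope : ∀ x, c < x → g x / x < g c / c := by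
    intro x hx
    rw [hgdiv, hgdiv, hνc]
    exact mul_lt_mul_of_pos_left
      (hslope _ (hνc ▸ mul_lt_mul_of_pos_left hx hν0)) hν0
  have hxsmem : xs ∈ Ioc 0 c := ⟨hxs0, hxsc.2.le⟩
  have hgc : g c / c < 1 := by
    have h : g c / c < g xs / xs := hganti hxsmem ⟨hc0, le_rfl⟩ hxsc.2
    rwa [hgxs, div_self hxs0.ne'] at h
  refine ⟨?_, ?_, hc0, ?_, hganti, hgslope, (div_lt_one hc0).1 hgc, hxsc, hgxs, ?_⟩
  · rw [funext hg]
    exact hf_cont.comp (by fun_prop) fun x hx => mul_nonneg hν0.le hx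
  · intro x hx
    rw [hg]
    exact hf_nonneg _ (mul_nonneg hν0.le hx)
  · intro x hx y hy hxy
    rw [hg, hg]
    exact hmono (hmaps x hx) (hmaps y hy) (mul_lt_mul_of_pos_left hxy hν0)
  · intro x hx hgx
    have h1 : g x / x = 1 := by rw [hgx, div_self hx.ne']
    have hxc : x ≤ c := by
      by_contra! h
      exact ((hgslope x h).trans hgc).ne h1
    refine hganti.injOn ⟨hx, hxc⟩ hxsmem ?_
    simp only [h1, hgxs, div_self hxs0.ne']
end

section
/- Let f satisfy Assumption (S) with parameter b, let x* ∈ (f(0), f(b)), set ν := f⁻¹(x*)/x*, g(x) := f(ν x), c := b/ν, and let d satisfy 0 < d < min{ c − g(c), max_{x∈[0,x*]} (g(x) − x) }. Define y₁ := sup{ x ∈ [0, x*] : g(x) − x ≥ d }, y₂ := inf{ x ∈ [x*, c] : g(x) − x ≤ −d }, y₃ := inf{ x ∈ [x*, ∞) : g(x) − d ≤ y₁ } (y₃ := ∞ if this set is empty). Then every solution of x_{n+1} = max{ f(ν x_n) + r_n, 0 } with −d ≤ r_n ≤ d and x₀ ∈ [y₁, y₃] satisfies: (i) for each ε > 0 there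 exists N = N(ε, x₀) such that y₁ ≤ x_n ≤ y₂ + ε for all n ≥ N; (ii) liminf_{n→∞} x_n ≥ y₁ and limsup_{n→∞} x_n ≤ y₂. -/
open Set Filter

/-- A function that is continuous on `[0, ∞)` and strictly increasing on `(0, b]` is
monotone on `[0, b]`. -/
lemma monotoneOn_Icc_of_strictMonoOn_Ioc {f : ℝ → ℝ} {b : ℝ}
    (hf : ContinuousOn f (Ici 0)) (hmono : StrictMonoOn f (Ioc 0 b)) :
    MonotoneOn f (Icc 0 b) := by
  intro u hu v hv huv
  rcases hu.1.eq_or_lt with rfl | hu0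
  · rcases hv.1.eq_or_lt with rfl | hv0
    · exact le_rfl
    have ht : Tendsto f (nhdsWithin 0 (Ioi 0)) (nhds (f 0)) :=
      (hf 0 self_mem_Ici).mono_left (nhdsWithin_mono 0 Ioi_subset_Ici_self)
    refine le_of_tendsto ht ?_
    filter_upwards [Ioc_mem_nhdsGT hv0] with w hw
    exact hmono.monotoneOn ⟨hw.1, hw.2.trans hv.2⟩ ⟨hv0, hv.2⟩ hw.2
  · exact hmono.monotoneOn ⟨hu0, hu.2⟩ ⟨hu0.trans_le huv, hv.2⟩ huv

/-- A nonlinear contraction estimate: if the excess of `x n` over `y` shrinks by a factor `ρ`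
whenever it is positive, and stays nonpositive otherwise, it decays geometrically. -/
lemma sub_le_pow_mul_max {x : ℕ → ℝ} {y ρ : ℝ} (hρ : 0 ≤ ρ)
    (hle : ∀ n, x n ≤ y → x (n + 1) ≤ y)
    (hgt : ∀ n, y < x n → x (n + 1) - y ≤ ρ * (x n - y)) (n : ℕ) :
    x n - y ≤ ρ ^ n * max (x 0 - y) 0 := by
  induction n with
  | zero => simp
  | succ n ih =>
    rcases le_or_gt (x n) y with h | h
    · have h1 := hle n h
      have h2 : 0 ≤ ρ ^ (n + 1) * max (x 0 - y) 0 := by positivity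
      linarith
    · calc x (n + 1) - y ≤ ρ * (x n - y) := hgt n h
        _ ≤ ρ * (ρ ^ n * max (x 0 - y) 0) := by gcongr
        _ = ρ ^ (n + 1) * max (x 0 - y) 0 := by ring

/-- (Lemma 4.3) Under Assumption (S), with `ν = f⁻¹(x*)/x*`,
`g(x) = f(ν x)`, `c = b/ν`, `d` as in (4.1) and `y₁, y₂, y₃` as in Lemma 4.1,
every solution of `x_{n+1} = max{f(ν x_n) + r_n, 0}` with `−d ≤ r_n ≤ d` and
`x₀ ∈ [y₁, y₃]` satisfies: (i) for each `ε > 0`, `y₁ ≤ x_n ≤ y₂ + ε` for all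
large `n`; (ii) `liminf x_n ≥ y₁` and `limsup x_n ≤ y₂`. -/
theorem stmt_14
    (f : ℝ → ℝ) (b : ℝ)
    (hf_cont : ContinuousOn f (Set.Ici 0))
    (hf_nonneg : ∀ x, 0 ≤ x → 0 ≤ f x)
    (hb : 0 < b)
    (hmono : StrictMonoOn f (Set.Ioc 0 b))
    (hratio : StrictAntiOn (fun x => f x / x) (Set.Ioc 0 b))
    (hfb : b < f b)
    (hslope : ∀ x, b < x → f x / x < f b / b)
    (finv : ℝ → ℝ)
    (hfinv : ∀ y ∈ Set.Icc (f 0) (f b), finv y ∈ Set.Icc 0 b ∧ f (finv y) = y)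
    (xs : ℝ) (hxs : xs ∈ Set.Ioo (f 0) (f b))
    (ν : ℝ) (hν : ν = finv xs / xs)
    (g : ℝ → ℝ) (hg : ∀ x, g x = f (ν * x))
    (c : ℝ) (hcdef : c = b / ν)
    (d : ℝ) (hdpos : 0 < d)
    (hd : d < min (c - g c) (sSup ((fun x => g x - x) '' Set.Icc 0 xs)))
    (y1 y2 : ℝ)
    (hy1 : y1 = sSup {x | x ∈ Set.Icc 0 xs ∧ d ≤ g x - x})
    (hy2 : y2 = sInf {x | x ∈ Set.Icc xs c ∧ g x - x ≤ -d})
    (r : ℕ → ℝ) (hr : ∀ n, -d ≤ r n ∧ r n ≤ d)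
    (x : ℕ → ℝ)
    (hrec : ∀ n, x (n + 1) = max (f (ν * x n) + r n) 0)
    (hx0l : y1 ≤ x 0)
    (hx0r : {w : ℝ | xs ≤ w ∧ g w - d ≤ y1}.Nonempty →
      x 0 ≤ sInf {w : ℝ | xs ≤ w ∧ g w - d ≤ y1}) :
    (∀ ε > 0, ∃ N : ℕ, ∀ n ≥ N, y1 ≤ x n ∧ x n ≤ y2 + ε) ∧
    y1 ≤ Filter.liminf x Filter.atTop ∧
    Filter.limsup x Filter.atTop ≤ y2 := by
  have hmono' := monotoneOn_Icc_of_strictMonoOn_Ioc hf_cont hmono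
  have hxs0 : 0 < xs := (hf_nonneg 0 le_rfl).trans_lt hxs.1
  obtain ⟨⟨hp0, hpb⟩, hfp⟩ := hfinv xs ⟨hxs.1.le, hxs.2.le⟩
  set p := finv xs
  have hp : 0 < p := by
    refine hp0.lt_of_ne fun h => ?_
    rw [← h] at hfp
    exact hxs.1.ne hfp
  have hpb : p < b := by
    refine hpb.lt_of_ne fun h => ?_
    rw [h] at hfp
    exact hxs.2.ne hfp.symm
  have hν0 : 0 < ν := by rw [hν]; positivity
  have hνxs : ν * xs = p := by rw [hν]; field_simp
  have hνc : ν * c = b := by rw [hcdef]; field_simp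
  have hgxs : g xs = xs := by rw [hg, hνxs, hfp]
  have hxc : xs < c := by
    rw [← mul_lt_mul_iff_right₀ hν0, hνxs, hνc]
    exact hpb
  have hgmono : MonotoneOn g (Icc 0 c) := by
    intro u hu v hv huv
    rw [hg, hg]
    have key : ∀ w ∈ Icc 0 c, ν * w ∈ Icc 0 b := fun w hw =>
      ⟨mul_nonneg hν0.le hw.1, hνc ▸ mul_le_mul_of_nonneg_left hw.2 hν0.le⟩
    exact hmono' (key u hu) (key v hv) (mul_le_mul_of_nonneg_left huv hν0.le)
  have hgcont : ContinuousOn g (Ici 0) := by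
    have : g = fun x => f (ν * x) := funext hg
    rw [this]
    exact hf_cont.comp (by fun_prop) fun w hw => mul_nonneg hν0.le hw
  have hgnn : ∀ w, 0 ≤ w → 0 ≤ g w := fun w hw => by
    rw [hg]; exact hf_nonneg _ (mul_nonneg hν0.le hw)
  have hgratio : ∀ u v, 0 < u → u ≤ c → u < v → g v * u < g u * v := by
    intro u v hu huc huv
    have hub : ν * u ≤ b := hνc ▸ mul_le_mul_of_nonneg_left huc hν0.le
    have huv' : ν * u < ν * v := mul_lt_mul_of_pos_left huv hν0
    have hu' : 0 < ν * u := mul_pos hν0 hu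
    have h : f (ν * v) / (ν * v) < f (ν * u) / (ν * u) := by
      rcases le_or_gt (ν * v) b with hv | hv
      · exact hratio ⟨hu', hub⟩ ⟨hu'.trans huv', hv⟩ huv'
      · exact (hslope _ hv).trans_le
          (hratio.antitoneOn ⟨hu', hub⟩ ⟨hb, le_rfl⟩ hub)
    rw [div_lt_div_iff₀ (hu'.trans huv') hu'] at h
    rw [hg, hg]
    refine lt_of_mul_lt_mul_left ?_ hν0.le
    linarith
  rw [lt_min_iff] at hd
  have hsub : ContinuousOn (fun w => g w - w) (Ici 0) := hgcont.sub continuousOn_id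
  have hy1mem : y1 ∈ {x | x ∈ Icc 0 xs ∧ d ≤ g x - x} := by
    rw [hy1]
    refine IsClosed.csSup_mem ?_ ?_ ⟨xs, fun w hw => hw.1.2⟩
    · exact (hsub.mono Icc_subset_Ici_self).preimage_isClosed_of_isClosed isClosed_Icc
        isClosed_Ici
    · obtain ⟨_, ⟨w, hw, rfl⟩, hdw⟩ := exists_lt_of_lt_csSup
        ((nonempty_Icc.2 hxs0.le).image _) hd.2
      exact ⟨w, hw, hdw.le⟩
  have hy2mem : y2 ∈ {x | x ∈ Icc xs c ∧ g x - x ≤ -d} := by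
    rw [hy2]
    refine IsClosed.csInf_mem ?_ ⟨c, ⟨hxc.le, le_rfl⟩, by linarith⟩ ⟨xs, fun w hw => hw.1.1⟩
    exact (hsub.mono (Icc_subset_Ici_self.trans
      (Ici_subset_Ici.2 hxs0.le))).preimage_isClosed_of_isClosed isClosed_Icc isClosed_Iic
  obtain ⟨⟨hy10, hy1x⟩, hgy1⟩ := hy1mem
  obtain ⟨⟨hy2x, hy2c⟩, hgy2⟩ := hy2mem
  have hy20 : 0 < y2 := hxs0.trans_le hy2x
  have hy3 : ∀ w, xs ≤ w → w ≤ x 0 → y1 ≤ g w - d := by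
    intro w hw hw0
    by_contra! hlt
    have hne : {w : ℝ | xs ≤ w ∧ g w - d ≤ y1}.Nonempty := ⟨w, hw, hlt.le⟩
    have hbdd : BddBelow {w : ℝ | xs ≤ w ∧ g w - d ≤ y1} := ⟨xs, fun w hw => hw.1⟩
    have hxw : xs < w := by
      refine hw.lt_of_ne fun h => ?_
      have := hgmono ⟨hy10, hy1x.trans hxc.le⟩ ⟨hxs0.le, hxc.le⟩ hy1x
      rw [← h] at hlt
      linarith
    have hcat : ContinuousAt g w := hgcont.continuousAt (Ici_mem_nhds (hxs0.trans hxw))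
    have hev : ∀ᶠ z in nhds w, g z < y1 + d := hcat.eventually_lt_const (by linarith)
    obtain ⟨z, ⟨hz, hxz⟩, hzw⟩ := ((hev.and (lt_mem_nhds hxw)).filter_mono
      nhdsWithin_le_nhds |>.and (self_mem_nhdsWithin : Iio w ∈ nhdsWithin w (Iio w))).exists
    have := csInf_le hbdd (show z ∈ {w : ℝ | xs ≤ w ∧ g w - d ≤ y1} from
      ⟨hxz.le, by linarith⟩)
    have h0 := hx0r hne
    have : z < w := hzw
    linarith
  have hrec' : ∀ n, x (n + 1) = max (g (x n) + r n) 0 := fun n => by rw [hg, hrec]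
  have hρ : 0 ≤ (y2 - d) / y2 := div_nonneg (by linarith [hgnn y2 hy20.le]) hy20.le
  have hρ1 : (y2 - d) / y2 < 1 := by rw [div_lt_one hy20]; linarith
  have hup : ∀ n, 0 ≤ x n → x (n + 1) ≤ g (x n) + d := fun n h => by
    rw [hrec']
    exact max_le (by linarith [(hr n).2]) (by linarith [hgnn _ h])
  have hx_nonneg : ∀ n, 0 ≤ x n := by
    intro n
    cases n with
    | zero => exact hy10.trans hx0l
    | succ n => rw [hrec']; exact le_max_right _ _
  have hle : ∀ n, x n ≤ y2 → x (n + 1) ≤ y2 := fun n h => by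
    have h1 := hgmono ⟨hx_nonneg n, h.trans hy2c⟩ ⟨hy20.le, hy2c⟩ h
    linarith [hup n (hx_nonneg n)]
  have hgt : ∀ n, y2 < x n → x (n + 1) - y2 ≤ (y2 - d) / y2 * (x n - y2) := fun n h => by
    have h1 := hgratio y2 (x n) hy20 hy2c h
    have h2 : g y2 * x n ≤ (y2 - d) * x n :=
      mul_le_mul_of_nonneg_right (by linarith) (hx_nonneg n)
    have h3 : g (x n) ≤ (y2 - d) * x n / y2 := by
      rw [le_div_iff₀ hy20]; linarith
    have h4 : (y2 - d) / y2 * (x n - y2) = (y2 - d) * x n / y2 - (y2 - d) := by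
      field_simp
    linarith [hup n (hx_nonneg n)]
  have hgeom := sub_le_pow_mul_max hρ hle hgt
  have hbd : ∀ n, y2 < x n → x n ≤ x 0 := by
    intro n h
    have h1 := hgeom n
    have h2 : ((y2 - d) / y2) ^ n * max (x 0 - y2) 0 ≤ max (x 0 - y2) 0 :=
      mul_le_of_le_one_left (le_max_right _ _) (pow_le_one₀ hρ hρ1.le)
    rcases le_max_iff.1 (h1.trans h2) with h3 | h3 <;> linarith
  have hlow : ∀ n, y1 ≤ x n := by
    intro n
    induction n with
    | zero => exact hx0l
    | succ n ih =>
      have : y1 ≤ g (x n) - d := by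
        rcases le_or_gt (x n) y2 with h | h
        · have := hgmono ⟨hy10, hy1x.trans hxc.le⟩ ⟨hx_nonneg n, h.trans hy2c⟩ ih
          linarith
        · exact hy3 _ (hy2x.trans h.le) (hbd n h)
      rw [hrec']
      exact le_max_of_le_left (by linarith [(hr n).1])
  have hmain : ∀ ε > 0, ∃ N : ℕ, ∀ n ≥ N, y1 ≤ x n ∧ x n ≤ y2 + ε := by
    intro ε hε
    have ht : Tendsto (fun n : ℕ => ((y2 - d) / y2) ^ n * max (x 0 - y2) 0) atTop (nhds 0) := by
      simpa using (tendsto_pow_atTop_nhds_zero_of_lt_one hρ hρ1).mul_const (max (x 0 - y2) 0)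
    obtain ⟨N, hN⟩ := eventually_atTop.1 (ht.eventually_lt_const hε)
    exact ⟨N, fun n hn => ⟨hlow n, by linarith [hN n hn, hgeom n]⟩⟩
  have hev : ∀ ε > 0, ∀ᶠ n in atTop, x n ≤ y2 + ε := fun ε hε =>
    let ⟨N, hN⟩ := hmain ε hε
    eventually_atTop.2 ⟨N, fun n hn => (hN n hn).2⟩
  have hbelow : IsBoundedUnder (· ≥ ·) atTop x := isBoundedUnder_of ⟨y1, hlow⟩
  have habove : IsBoundedUnder (· ≤ ·) atTop x := ⟨y2 + 1, hev 1 one_pos⟩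
  exact ⟨hmain, le_liminf_of_le habove.isCoboundedUnder_ge (Eventually.of_forall hlow),
    le_of_forall_pos_le_add fun ε hε => limsup_le_of_le hbelow.isCoboundedUnder_le (hev ε hε)⟩
end
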